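/- Let N ≥ 1 and let z_1, …, z_N ∈ ℝ be real numbers such that z_i = 0 for some index i. Let c ≥ 0 satisfy c·exp(c+1) = N − 1. Then Σ_{j=1}^N z_j² exp(−z_j²) ≤ c · Σ_{j=1}^N exp(−z_j²); equivalently, the softmax-weighted average (Σ_j z_j² exp(−z_j²)) / (Σ_k exp(−z_k²)) is at most c. -/

import Mathlib

open BigOperators

/-- The function `t ↦ (t - c) exp(-t)` is maximal at `t = c + 1`. -/
lemma sub_mul_exp_neg_le (t c : ℝ) :
    (t - c) * Real.exp (-t) ≤ Real.exp (-(c + 1)) := by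
  calc (t - c) * Real.exp (-t) ≤ Real.exp (t - c - 1) * Real.exp (-t) := by
        gcongr
        linarith [Real.add_one_le_exp (t - c - 1)]
    _ = Real.exp (-(c + 1)) := by
        rw [← Real.exp_add]
        ring_nf

/-- The scalar softmax inequality: if `zᵢ = 0` for some `i` and
`c·exp(c+1) = N − 1` with `c ≥ 0`, then
`∑ⱼ zⱼ² exp(−zⱼ²) ≤ c · ∑ⱼ exp(−zⱼ²)`. -/
theorem softmax_weighted_square_le
    (N : ℕ) (hN : 1 ≤ N) (z : Fin N → ℝ) (i : Fin N) (hz : z i = 0)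
    (c : ℝ) (hc0 : 0 ≤ c) (hc : c * Real.exp (c + 1) = (N : ℝ) - 1) :
    ∑ j, z j ^ 2 * Real.exp (-(z j ^ 2)) ≤ c * ∑ j, Real.exp (-(z j ^ 2)) := by
  rw [← sub_nonpos, Finset.mul_sum, ← Finset.sum_sub_distrib]
  simp_rw [← sub_mul]
  rw [← Finset.add_sum_erase _ _ (Finset.mem_univ i)]
  have hsum := Finset.sum_le_card_nsmul (Finset.univ.erase i)
    (fun j => (z j ^ 2 - c) * Real.exp (-(z j ^ 2))) _
    fun j _ => sub_mul_exp_neg_le (z j ^ 2) c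
  have hcard : ((Finset.univ.erase i).card : ℝ) = N - 1 := by
    rw [Finset.card_erase_of_mem (Finset.mem_univ i), Finset.card_univ, Fintype.card_fin,
      Nat.cast_sub hN, Nat.cast_one]
  rw [nsmul_eq_mul, hcard, ← hc, mul_assoc, ← Real.exp_add, add_neg_cancel, Real.exp_zero,
    mul_one] at hsum
  have hi : (z i ^ 2 - c) * Real.exp (-(z i ^ 2)) = -c := by simp [hz]
  linarith
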